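/- Let m ≥ 1 be a natural number, α real with m − 1 < α < m, d_0, …, d_{m−1} ∈ ℝ, and let F : ℝ → ℝ be continuous on [0,1]. Define y(x) = ∑_{k=0}^{m−1} d_k x^k/k! + (1/Γ(α)) ∫_0^x (x−s)^{α−1} F(s) ds for x ∈ [0,1]. Then for each i = 0, …, m−1, the i-th derivative of y at 0 exists and equals d_i. -/

import Mathlib

open MeasureTheory Set

theorem aux_int (β : ℝ) (hβ : 0 < β) (a x : ℝ) :
    IntervalIntegrable (fun t : ℝ => (t - a) ^ (β - 1)) volume a x := by
  have h := (intervalIntegral.intervalIntegrable_rpow' (a := 0) (b := x - a)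
    (r := β - 1) (by linarith)).comp_sub_right a
  simpa using h

theorem aux_int2 (β : ℝ) (hβ : 0 < β) (x : ℝ) :
    IntervalIntegrable (fun t : ℝ => (x - t) ^ (β - 1)) volume 0 x := by
  have h := (intervalIntegral.intervalIntegrable_rpow' (a := 0) (b := x)
    (r := β - 1) (by linarith)).comp_sub_left x
  simpa using h.symm

theorem aux_cont (β : ℝ) (hβ : 0 < β) (G : ℝ → ℝ) (hG : Continuous G) (M : ℝ)
    (hM : ∀ x, |G x| ≤ M) :
    Continuous (fun x : ℝ => ∫ t in (0 : ℝ)..1, (1 - t) ^ (β - 1) * G (x * t)) := by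
  apply intervalIntegral.continuous_of_dominated_interval
    (bound := fun t => (1 - t) ^ (β - 1) * M)
  · intro x
    apply Measurable.aestronglyMeasurable
    have := hG.measurable
    fun_prop
  · intro x
    refine Filter.Eventually.of_forall fun t ht => ?_
    rw [uIoc_of_le zero_le_one] at ht
    have h0 : (0:ℝ) ≤ (1 - t) ^ (β - 1) := Real.rpow_nonneg (by linarith [ht.2]) _
    rw [Real.norm_eq_abs, abs_mul, abs_of_nonneg h0]
    exact mul_le_mul_of_nonneg_left (hM _) h0
  · exact (aux_int2 β hβ 1).mul_const M
  · refine Filter.Eventually.of_forall fun t ht => ?_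
    fun_prop

theorem aux_scale (β : ℝ) (hβ : 0 < β) (G : ℝ → ℝ) (x : ℝ) (hx : 0 ≤ x) :
    ∫ s in (0 : ℝ)..x, (x - s) ^ (β - 1) * G s =
      x ^ β * ∫ t in (0 : ℝ)..1, (1 - t) ^ (β - 1) * G (x * t) := by
  rcases hx.eq_or_lt with rfl | hx
  · simp [hβ.ne']
  have h := intervalIntegral.integral_comp_mul_left (a := 0) (b := 1) (c := x)
    (fun s => (x - s) ^ (β - 1) * G s) hx.ne'
  simp only [mul_zero, mul_one, smul_eq_mul] at h
  have h2 : ∫ t in (0 : ℝ)..1, (x - x * t) ^ (β - 1) * G (x * t) =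
      x ^ (β - 1) * ∫ t in (0 : ℝ)..1, (1 - t) ^ (β - 1) * G (x * t) := by
    rw [← intervalIntegral.integral_const_mul]
    apply intervalIntegral.integral_congr
    intro t ht
    rw [uIcc_of_le zero_le_one] at ht
    have : x - x * t = x * (1 - t) := by ring
    simp only [this]
    rw [Real.mul_rpow hx.le (by linarith [ht.2])]
    ring
  rw [h2] at h
  have h3 : x ^ β = x * x ^ (β - 1) := by
    rw [Real.rpow_sub_one hx.ne']; field_simp
  rw [h3, mul_assoc, h]
  field_simp

theorem aux_K_cont (β : ℝ) (hβ : 0 < β) (G : ℝ → ℝ) (hG : Continuous G) (M : ℝ)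
    (hM : ∀ x, |G x| ≤ M) :
    ContinuousOn (fun x : ℝ => ∫ s in (0 : ℝ)..x, (x - s) ^ (β - 1) * G s) (Ici 0) := by
  have h : Continuous (fun x : ℝ =>
      x ^ β * ∫ t in (0 : ℝ)..1, (1 - t) ^ (β - 1) * G (x * t)) :=
    (Real.continuous_rpow_const hβ.le).mul (aux_cont β hβ G hG M hM)
  exact h.continuousOn.congr fun x hx => aux_scale β hβ G x hx

theorem aux_inner (β : ℝ) (hβ : 0 < β) (x s : ℝ) (hs : s ∈ Ioc 0 x) :
    ∫ t in Ioc 0 x, (Ioi s).indicator (fun t => (t - s) ^ (β - 1)) t = (x - s) ^ β / β := by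
  rw [setIntegral_indicator measurableSet_Ioi]
  have : Ioc 0 x ∩ Ioi s = Ioc s x := by
    ext t; simp only [mem_inter_iff, mem_Ioc, mem_Ioi]
    have := hs.1
    constructor
    · rintro ⟨⟨_, h⟩, h'⟩; exact ⟨h', h⟩
    · rintro ⟨h, h'⟩; exact ⟨⟨by linarith, h'⟩, h⟩
  rw [this, ← intervalIntegral.integral_of_le hs.2,
    intervalIntegral.integral_comp_sub_right (fun u => u ^ (β - 1)) s,
    integral_rpow (Or.inl (by linarith))]
  simp [hβ.ne']

theorem aux_fubini (β : ℝ) (hβ : 0 < β) (G : ℝ → ℝ) (hG : Continuous G) (x : ℝ) (hx : 0 ≤ x) :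
    ∫ t in (0 : ℝ)..x, (∫ s in (0 : ℝ)..t, (t - s) ^ (β - 1) * G s) =
      (1 / β) * ∫ s in (0 : ℝ)..x, (x - s) ^ β * G s := by
  let φ : ℝ → ℝ → ℝ := fun t s => (Ioi s).indicator (fun t => (t - s) ^ (β - 1)) t * G s
  have hmeas : Measurable (Function.uncurry φ) := by
    have h1 : Function.uncurry φ = fun p : ℝ × ℝ =>
        ({p : ℝ × ℝ | p.2 < p.1}.indicator (fun p => (p.1 - p.2) ^ (β - 1)) p) * G p.2 := by
      ext ⟨t, s⟩
      simp [φ, Function.uncurry, indicator]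
    rw [h1]
    have := hG.measurable
    apply Measurable.mul
    · apply Measurable.indicator (by fun_prop)
      exact measurableSet_lt measurable_snd measurable_fst
    · fun_prop
  have hcont : Continuous (fun s => (x - s) ^ β / β * |G s|) := by
    have : Continuous (fun s : ℝ => (x - s) ^ β) :=
      (Real.continuous_rpow_const hβ.le).comp (by fun_prop)
    fun_prop
  have hint : Integrable (Function.uncurry φ)
      ((volume.restrict (Ioc 0 x)).prod (volume.restrict (Ioc 0 x))) := by
    rw [integrable_prod_iff' hmeas.aestronglyMeasurable]
    constructor
    · refine (ae_restrict_mem measurableSet_Ioc).mono fun s hs => ?_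
      simp only [Function.uncurry, φ]
      apply Integrable.mul_const
      rw [integrable_indicator_iff measurableSet_Ioi, IntegrableOn,
        Measure.restrict_restrict measurableSet_Ioi]
      have h := (intervalIntegrable_iff_integrableOn_Ioc_of_le hs.2).1 (aux_int β hβ s x)
      exact h.mono_set (fun t ht => ⟨ht.1, ht.2.2⟩)
    · have h : IntegrableOn (fun s => (x - s) ^ β / β * |G s|) (Ioc 0 x) volume :=
        (hcont.integrableOn_Icc (a := 0) (b := x)).mono_set Ioc_subset_Icc_self
      refine Integrable.congr h ?_
      refine (ae_restrict_mem measurableSet_Ioc).mono fun s hs => ?_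
      simp only [Function.uncurry, φ]
      rw [← aux_inner β hβ x s hs, ← integral_mul_const]
      congr 1
      ext t
      have h0 : 0 ≤ (Ioi s).indicator (fun t => (t - s) ^ (β - 1)) t := by
        apply indicator_nonneg
        intro t ht
        exact Real.rpow_nonneg (by linarith [mem_Ioi.1 ht]) _
      rw [Real.norm_eq_abs, abs_mul, abs_of_nonneg h0]
  have hsw := integral_integral_swap hint
  rw [intervalIntegral.integral_of_le hx, intervalIntegral.integral_of_le hx]
  calc _ = ∫ t in Ioc 0 x, ∫ s in Ioc 0 x, φ t s := by
        apply setIntegral_congr_fun measurableSet_Ioc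
        intro t ht
        have h1 : ∀ s, φ t s = (Iio t).indicator (fun s => (t - s) ^ (β - 1) * G s) s := by
          intro s
          by_cases h : s < t <;> simp [φ, indicator, h]
        simp only [h1]
        rw [setIntegral_indicator measurableSet_Iio, intervalIntegral.integral_of_le ht.1.le]
        have : Ioc 0 x ∩ Iio t = Ioo 0 t := by
          ext s; simp only [mem_inter_iff, mem_Ioc, mem_Iio, mem_Ioo]
          have := ht.2
          constructor
          · rintro ⟨⟨h, _⟩, h'⟩; exact ⟨h, h'⟩
          · rintro ⟨h, h'⟩; exact ⟨⟨h, by linarith⟩, h'⟩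
        rw [this, integral_Ioc_eq_integral_Ioo]
    _ = _ := hsw
    _ = _ := by
        rw [← integral_const_mul]
        apply setIntegral_congr_fun measurableSet_Ioc
        intro s hs
        simp only [φ]
        rw [integral_mul_const, aux_inner β hβ x s hs]
        ring

theorem aux_deriv (β : ℝ) (hβ : 0 < β) (G : ℝ → ℝ) (hG : Continuous G) (M : ℝ)
    (hM : ∀ x, |G x| ≤ M) (x : ℝ) (hx : x ∈ Icc (0 : ℝ) 1) :
    HasDerivWithinAt (fun x : ℝ => ∫ s in (0 : ℝ)..x, (x - s) ^ β * G s)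
      (β * ∫ s in (0 : ℝ)..x, (x - s) ^ (β - 1) * G s) (Icc 0 1) x := by
  set K : ℝ → ℝ := fun x : ℝ => ∫ s in (0 : ℝ)..x, (x - s) ^ (β - 1) * G s with hK
  have hc : Continuous (fun t => K (max t 0)) := by
    have := aux_K_cont β hβ G hG M hM
    exact this.comp_continuous (by fun_prop) (fun t => mem_Ici.2 (le_max_right _ _))
  have hd := ((hc.integral_hasStrictDerivAt 0 x).hasDerivAt.const_mul β).hasDerivWithinAt
    (s := Icc 0 1)
  rw [max_eq_left hx.1] at hd
  have hE : ∀ z ∈ Icc (0 : ℝ) 1, ∫ s in (0 : ℝ)..z, (z - s) ^ β * G s =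
      β * ∫ t in (0 : ℝ)..z, K (max t 0) := by
    intro z hz
    have h1 : ∫ t in (0 : ℝ)..z, K (max t 0) = ∫ t in (0 : ℝ)..z, K t := by
      apply intervalIntegral.integral_congr
      intro t ht
      rw [uIcc_of_le hz.1] at ht
      simp only [max_eq_left ht.1]
    rw [h1, hK, aux_fubini β hβ G hG z hz.1]
    field_simp
  exact hd.congr hE (hE x hx)

theorem aux_poly (n : ℕ) (d : ℕ → ℝ) (x : ℝ) :
    HasDerivAt (fun x : ℝ => ∑ j ∈ Finset.range (n + 1), d j * x ^ j / j.factorial)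
      (∑ j ∈ Finset.range n, d (j + 1) * x ^ j / j.factorial) x := by
  have h : ∀ x : ℝ, ∑ j ∈ Finset.range (n + 1), d j * x ^ j / j.factorial =
      (∑ j ∈ Finset.range n, d (j + 1) * x ^ (j + 1) / (j + 1).factorial) + d 0 := by
    intro x; rw [Finset.sum_range_succ']; simp
  simp only [h]
  apply HasDerivAt.add_const
  apply HasDerivAt.fun_sum
  intro j _
  have h1 := ((hasDerivAt_pow (j + 1) x).const_mul (d (j + 1))).div_const ((j + 1).factorial : ℝ)
  refine h1.congr_deriv ?_
  rw [Nat.factorial_succ]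
  have : (j.factorial : ℝ) ≠ 0 := by positivity
  push_cast
  field_simp

theorem aux_main (G : ℝ → ℝ) (hG : Continuous G) (M : ℝ) (hM : ∀ x, |G x| ≤ M) (n : ℕ) :
    ∀ (α : ℝ) (_ : (n : ℝ) < α) (c : ℝ) (d : ℕ → ℝ) (y : ℝ → ℝ)
    (_ : ∀ x ∈ Set.Icc (0 : ℝ) 1,
      y x = (∑ j ∈ Finset.range (n + 1), d j * x ^ j / j.factorial) +
        c * ∫ s in (0 : ℝ)..x, (x - s) ^ (α - 1) * G s),
    ContDiffOn ℝ n y (Set.Icc 0 1) ∧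
    ∀ i < n + 1, iteratedDerivWithin i y (Set.Icc 0 1) 0 = d i := by
  have hz : ∀ (n : ℕ) (d : ℕ → ℝ),
      (∑ j ∈ Finset.range (n + 1), d j * (0 : ℝ) ^ j / j.factorial) = d 0 := by
    intro n d; rw [Finset.sum_range_succ']; simp
  induction n with
  | zero =>
    intro α hα c d y hy
    constructor
    · rw [Nat.cast_zero, contDiffOn_zero]
      refine ContinuousOn.congr ?_ hy
      have := (aux_K_cont α (by simpa using hα) G hG M hM).mono
        (fun x (hx : x ∈ Icc (0 : ℝ) 1) => hx.1)
      simp only [zero_add, Finset.sum_range_one]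
      fun_prop
    · intro i hi
      obtain rfl : i = 0 := by omega
      rw [iteratedDerivWithin_zero, hy 0 (by simp), hz]
      simp
  | succ n ih =>
    intro α hα c d y hy
    push_cast at hα
    have hn : (0 : ℝ) ≤ n := by positivity
    have hD : ∀ x ∈ Icc (0 : ℝ) 1, HasDerivWithinAt y
        ((∑ j ∈ Finset.range (n + 1), d (j + 1) * x ^ j / j.factorial) +
          (c * (α - 1)) * ∫ s in (0 : ℝ)..x, (x - s) ^ (α - 1 - 1) * G s) (Icc 0 1) x := by
      intro x hx
      have h1 := (aux_poly (n + 1) d x).hasDerivWithinAt (s := Icc 0 1)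
      have h2 := (aux_deriv (α - 1) (by linarith) G hG M hM x hx).const_mul c
      rw [← mul_assoc] at h2
      exact (h1.add h2).congr hy (hy x hx)
    have hu : UniqueDiffOn ℝ (Icc (0 : ℝ) 1) := uniqueDiffOn_Icc zero_lt_one
    obtain ⟨h1, h2⟩ := ih (α - 1) (by linarith) (c * (α - 1)) (fun j => d (j + 1))
      (derivWithin y (Icc 0 1)) (fun x hx => (hD x hx).derivWithin (hu x hx))
    constructor
    · rw [Nat.cast_succ, contDiffOn_succ_iff_derivWithin hu]
      exact ⟨fun x hx => (hD x hx).differentiableWithinAt, by simp, h1⟩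
    · intro i hi
      cases i with
      | zero =>
        rw [iteratedDerivWithin_zero, hy 0 (by simp), hz]
        simp
      | succ i =>
        rw [iteratedDerivWithin_succ']
        exact h2 i (by omega)


/-- The solution of the integral equation automatically satisfies the initial conditions:
if `y(x) = ∑_{k<m} d_k x^k/k! + J^α F (x)` with `F` continuous on `[0,1]` and
`m - 1 < α < m`, then `y` is `(m-1)`-times continuously differentiable on `[0,1]` and its
`i`-th derivative at `0` (within `[0,1]`) equals `d_i` for `i = 0, …, m-1`. -/
theorem integral_equation_initial_conditions
    (m : ℕ) (hm : 1 ≤ m) (α : ℝ) (hα₁ : (m : ℝ) - 1 < α) (hα₂ : α < m)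
    (d : ℕ → ℝ) (F : ℝ → ℝ) (hF : ContinuousOn F (Set.Icc 0 1))
    (y : ℝ → ℝ)
    (hy : ∀ x ∈ Set.Icc (0 : ℝ) 1,
      y x = (∑ j ∈ Finset.range m, d j * x ^ j / j.factorial) +
        (1 / Real.Gamma α) * ∫ s in (0 : ℝ)..x, (x - s) ^ (α - 1) * F s) :
    ContDiffOn ℝ (m - 1 : ℕ) y (Set.Icc 0 1) ∧
    ∀ i < m, iteratedDerivWithin i y (Set.Icc 0 1) 0 = d i := by
  obtain ⟨n, rfl⟩ : ∃ n, m = n + 1 := ⟨m - 1, by omega⟩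
  have hGc : Continuous (Set.IccExtend (zero_le_one (α := ℝ)) ((Set.Icc (0 : ℝ) 1).domRestrict F)) :=
    hF.domRestrict.Icc_extend'
  obtain ⟨M, hM⟩ := isCompact_Icc.exists_bound_of_continuousOn hF
  refine aux_main _ hGc M ?_ n α ?_ (1 / Real.Gamma α) d y ?_
  · intro x
    exact hM _ (Set.projIcc (0 : ℝ) 1 zero_le_one x).2
  · push_cast at hα₁
    linarith
  · intro x hx
    rw [hy x hx]
    congr 2
    apply intervalIntegral.integral_congr
    intro s hs
    rw [Set.uIcc_of_le hx.1] at hs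
    have hs' : s ∈ Set.Icc (0 : ℝ) 1 := ⟨hs.1, hs.2.trans hx.2⟩
    simp only [Set.IccExtend_of_mem _ _ hs']
    rfl
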